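/- For all integers $r, C$ with $1 \leq r$ and $C \geq 2r$, the identity $\sum_{i=1}^{r-1} (r-i+1)\binom{r}{i-1}\binom{C-r}{r-i+1} = \frac{r(C-r)}{C}\binom{C}{r} - r(C-r)$ holds as an equality of rational numbers. -/

import Mathlib

/-- A weighted Vandermonde convolution with its last term removed. -/
theorem sum_range_sub_mul_choose_mul_choose (s m : ℕ) :
    ∑ j ∈ Finset.range s,
        ((s : ℚ) + 1 - j) * ((s + 1).choose j : ℚ) * ((m + 1).choose (s + 1 - j) : ℚ)
      = ((m : ℚ) + 1) * ((s + 1 + m).choose s : ℚ) - ((s : ℚ) + 1) * ((m : ℚ) + 1) := by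
  have absorb : ∀ j ∈ Finset.range (s + 1),
      ((s : ℚ) + 1 - j) * ((s + 1).choose j : ℚ) * ((m + 1).choose (s + 1 - j) : ℚ)
        = ((m : ℚ) + 1) * (((s + 1).choose j : ℚ) * (m.choose (s - j) : ℚ)) := by
    intro j hj
    have hjs : j ≤ s := Nat.lt_succ_iff.mp (Finset.mem_range.mp hj)
    have h : ((m : ℚ) + 1) * (m.choose (s - j) : ℚ)
        = ((m + 1).choose (s - j + 1) : ℚ) * (((s - j : ℕ) : ℚ) + 1) := by
      exact_mod_cast Nat.add_one_mul_choose_eq m (s - j)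
    rw [Nat.cast_sub hjs] at h
    rw [Nat.sub_add_comm hjs]
    linear_combination -((s + 1).choose j : ℚ) * h
  have vandermonde : ((s + 1 + m).choose s : ℚ)
      = ∑ j ∈ Finset.range (s + 1), ((s + 1).choose j : ℚ) * (m.choose (s - j) : ℚ) := by
    rw [Nat.add_choose_eq, Finset.Nat.sum_antidiagonal_eq_sum_range_succ_mk]
    push_cast
    rfl
  have total := Finset.sum_congr rfl absorb
  rw [← Finset.mul_sum, ← vandermonde, Finset.sum_range_succ] at total
  simp only [Nat.choose_succ_self_right, Nat.add_sub_cancel_left, Nat.choose_one_right] at total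
  push_cast at total
  linear_combination total

/-- For `r ≥ 1` and `C ≥ 2r`:
`∑_{i=1}^{r-1} (r-i+1) C(r,i-1) C(C-r,r-i+1) = (r(C-r)/C) C(C,r) - r(C-r)`
as rational numbers. -/
theorem weighted_sum_at_t_eq_C_sub_r_first (r C : ℕ) (hr : 1 ≤ r) (hC : 2 * r ≤ C) :
    ∑ i ∈ Finset.Icc 1 (r - 1),
        ((r : ℚ) - (i : ℚ) + 1) * (r.choose (i - 1) : ℚ) * ((C - r).choose (r - i + 1) : ℚ)
      = (r : ℚ) * ((C : ℚ) - (r : ℚ)) / (C : ℚ) * (C.choose r : ℚ) -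
          (r : ℚ) * ((C : ℚ) - (r : ℚ)) := by
  obtain ⟨s, rfl⟩ : ∃ s, r = s + 1 := ⟨r - 1, by omega⟩
  obtain ⟨m, rfl⟩ : ∃ m, C = s + 1 + m + 1 := ⟨C - (s + 2), by omega⟩
  have reindex : ∑ i ∈ Finset.Icc 1 (s + 1 - 1),
      (((s + 1 : ℕ) : ℚ) - (i : ℚ) + 1) * ((s + 1).choose (i - 1) : ℚ)
        * ((s + 1 + m + 1 - (s + 1)).choose (s + 1 - i + 1) : ℚ)
      = ∑ j ∈ Finset.range s,
        ((s : ℚ) + 1 - j) * ((s + 1).choose j : ℚ) * ((m + 1).choose (s + 1 - j) : ℚ) := by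
    rw [← Finset.Ico_add_one_right_eq_Icc, Finset.sum_Ico_eq_sum_range]
    refine Finset.sum_congr (by simp) fun j hj => ?_
    have hjs : j < s := by simpa using hj
    rw [show 1 + j - 1 = j by omega, show s + 1 + m + 1 - (s + 1) = m + 1 by omega,
      show s + 1 - (1 + j) + 1 = s + 1 - j by omega]
    push_cast
    ring
  have h : ((s : ℚ) + 1 + m + 1) * ((s + 1 + m).choose s : ℚ)
      = ((s + 1 + m + 1).choose (s + 1) : ℚ) * ((s : ℚ) + 1) := by
    exact_mod_cast Nat.add_one_mul_choose_eq (s + 1 + m) s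
  have hpos : (s : ℚ) + 1 + m + 1 ≠ 0 := by positivity
  rw [reindex, sum_range_sub_mul_choose_mul_choose]
  push_cast
  field_simp
  linear_combination ((m : ℚ) + 1) * h
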